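/- arXiv:2111.13989 — 3 statements merged into one kernel-verified Lean document; each statement's English description precedes it below -/
import Mathlib

section
/- Correctness of the reduction from set cover to multi-interval set cover: Let n, m be natural numbers with 0 < n, and let S : Fin m → Set (Fin n) be a family of sets over the universe Fin n, where each element j ∈ Fin n is encoded as the real interval Icc (j : ℝ) ((j : ℝ) + 1). Then for every set of indices I ⊆ Fin m, the interval Set.Icc (0 : ℝ) n is contained in ⋃_{i ∈ I} ⋃_{j ∈ S i} Set.Icc (j : ℝ) ((j : ℝ) + 1) if and only if ⋃_{i ∈ I} S i = Set.univ; that is, I is a feasible solution of the constructed multi-interval set cover instance if and only if I is a feasible solution of the original set cover instance. -/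
theorem natCast_add_half_mem_Icc_iff {j k : ℕ} :
    (j : ℝ) + 1 / 2 ∈ Set.Icc (k : ℝ) (k + 1) ↔ k = j := by
  constructor
  · rintro ⟨h₁, h₂⟩
    have h₃ : (k : ℝ) < j + 1 := by linarith
    have h₄ : (j : ℝ) < k + 1 := by linarith
    norm_cast at h₃ h₄
    omega
  · rintro rfl
    constructor <;> linarith

theorem exists_fin_mem_Icc {n : ℕ} (hn : 0 < n) {x : ℝ} (hx : x ∈ Set.Icc (0 : ℝ) n) :
    ∃ j : Fin n, x ∈ Set.Icc ((j : ℕ) : ℝ) (((j : ℕ) : ℝ) + 1) := by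
  obtain ⟨h₀, h₁⟩ := hx
  rcases h₁.lt_or_eq with h | rfl
  · exact ⟨⟨⌊x⌋₊, (Nat.floor_lt h₀).2 h⟩, Nat.floor_le h₀, (Nat.lt_floor_add_one x).le⟩
  · obtain ⟨k, rfl⟩ := Nat.exists_eq_succ_of_ne_zero hn.ne'
    exact ⟨Fin.last k, by simp⟩

theorem setCover_to_multiIntervalSetCover_correct
    (n m : ℕ) (hn : 0 < n) (S : Fin m → Set (Fin n)) (I : Set (Fin m)) :
    Set.Icc (0 : ℝ) n ⊆
        ⋃ i ∈ I, ⋃ j ∈ S i, Set.Icc ((j : ℕ) : ℝ) (((j : ℕ) : ℝ) + 1) ↔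
      ⋃ i ∈ I, S i = Set.univ := by
  constructor
  · refine fun h => Set.eq_univ_of_forall fun j => ?_
    have hj : ((j : ℕ) : ℝ) + 1 ≤ n := by exact_mod_cast j.isLt
    have hmem : ((j : ℕ) : ℝ) + 1 / 2 ∈ Set.Icc (0 : ℝ) n :=
      ⟨by positivity, by linarith⟩
    obtain ⟨i, hi, k, hk, hjk⟩ := by simpa only [Set.mem_iUnion, exists_prop] using h hmem
    obtain rfl := Fin.ext (natCast_add_half_mem_Icc_iff.1 hjk)
    exact Set.mem_biUnion hi hk
  · intro h x hx
    obtain ⟨j, hj⟩ := exists_fin_mem_Icc hn hx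
    obtain ⟨i, hi, hji⟩ := Set.mem_iUnion₂.1 (h ▸ Set.mem_univ j)
    exact Set.mem_biUnion hi (Set.mem_biUnion hji hj)
end

section
/- A connected set covered by k balls of radius ρ has small diameter: Let S be a nonempty connected subset of a metric space, let k ≥ 1, ρ ≥ 0, and let c : Fin k → E be centers such that S ⊆ ⋃_{i} Metric.closedBall (c i) ρ. Then Metric.diam S ≤ 2·k·ρ. (Consequently, if a connected polygon with smallest enclosing disk radius r₀ is covered by k clusters of radius ρ, then ρ ≥ r₀/(2k).) -/
/-- If a function on the vertices of a graph moves by at most `d` along each edge, then it moves by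
at most `d` times the length along any walk. -/
theorem dist_le_walk_length_mul {V E : Type*} [PseudoMetricSpace E]
    {G : SimpleGraph V} {c : V → E} {d : ℝ} (h : ∀ i j, G.Adj i j → dist (c i) (c j) ≤ d)
    {i j : V} (p : G.Walk i j) :
    dist (c i) (c j) ≤ p.length * d := by
  induction p with
  | nil => simp
  | @cons u v w huv p ih =>
    rw [SimpleGraph.Walk.length_cons]
    push_cast
    linarith [dist_triangle (c u) (c v) (c w), h u v huv]

/-- If a preconnected set is covered by finitely many closed sets, then any two members of the
cover that meet the set are joined in the intersection graph of the cover. -/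
theorem IsPreconnected.reachable_of_subset_iUnion_isClosed {X ι : Type*} [TopologicalSpace X]
    [Finite ι] {S : Set X} (hS : IsPreconnected S) {B : ι → Set X} (hB : ∀ i, IsClosed (B i))
    (hcov : S ⊆ ⋃ i, B i) {i j : ι} (hi : (S ∩ B i).Nonempty) (hj : (S ∩ B j).Nonempty) :
    (SimpleGraph.fromRel fun i j => (B i ∩ B j).Nonempty).Reachable i j := by
  set G := SimpleGraph.fromRel fun i j => (B i ∩ B j).Nonempty with hG
  by_contra hij
  obtain ⟨x, hxS, hxi⟩ := hi
  obtain ⟨y, hyS, hyj⟩ := hj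
  have hclosed (s : Set ι) : IsClosed (⋃ l ∈ s, B l) :=
    s.toFinite.isClosed_biUnion fun l _ => hB l
  obtain ⟨z, -, hz₁, hz₂⟩ := isPreconnected_closed_iff.1 hS
    (⋃ l ∈ {l | G.Reachable i l}, B l) (⋃ l ∈ {l | ¬ G.Reachable i l}, B l)
    (hclosed _) (hclosed _)
    (fun w hw => by
      obtain ⟨l, hl⟩ := Set.mem_iUnion.1 (hcov hw)
      by_cases h : G.Reachable i l
      · exact Or.inl (Set.mem_biUnion h hl)
      · exact Or.inr (Set.mem_biUnion h hl))
    ⟨x, hxS, Set.mem_biUnion (SimpleGraph.Reachable.refl i) hxi⟩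
    ⟨y, hyS, Set.mem_biUnion hij hyj⟩
  obtain ⟨a, ha, hza⟩ := Set.mem_iUnion₂.1 hz₁
  obtain ⟨b, hb, hzb⟩ := Set.mem_iUnion₂.1 hz₂
  have hab : a ≠ b := by
    rintro rfl
    exact hb ha
  have hadj : G.Adj a b := by
    rw [hG, SimpleGraph.fromRel_adj]
    exact ⟨hab, Or.inl ⟨z, hza, hzb⟩⟩
  exact hb (SimpleGraph.Reachable.trans ha hadj.reachable)

theorem connected_covered_by_k_balls_diam_le
    {E : Type*} [MetricSpace E] (S : Set E) (hS : IsConnected S)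
    (k : ℕ) (hk : 1 ≤ k) (ρ : ℝ) (hρ : 0 ≤ ρ) (c : Fin k → E)
    (hcov : S ⊆ ⋃ i, Metric.closedBall (c i) ρ) :
    Metric.diam S ≤ 2 * k * ρ := by
  refine Metric.diam_le_of_forall_dist_le (by positivity) fun x hx y hy => ?_
  obtain ⟨i, hi⟩ := Set.mem_iUnion.1 (hcov hx)
  obtain ⟨j, hj⟩ := Set.mem_iUnion.1 (hcov hy)
  obtain ⟨p, hp⟩ := (hS.isPreconnected.reachable_of_subset_iUnion_isClosed
    (fun _ => Metric.isClosed_closedBall) hcov ⟨x, hx, hi⟩ ⟨y, hy, hj⟩).exists_isPath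
  have hdist := dist_le_walk_length_mul (c := c) (d := 2 * ρ) (p := p) fun a b hab => by
    rw [SimpleGraph.fromRel_adj, Set.inter_comm (Metric.closedBall (c b) ρ), or_self] at hab
    obtain ⟨-, z, hza, hzb⟩ := hab
    linarith [dist_triangle_left (c a) (c b) z, Metric.mem_closedBall.1 hza,
      Metric.mem_closedBall.1 hzb]
  have hlen : (p.length : ℝ) + 1 ≤ k := by
    have := hp.length_lt
    rw [Fintype.card_fin] at this
    exact_mod_cast this
  have hxi := Metric.mem_closedBall.1 hi
  have hyj := Metric.mem_closedBall'.1 hj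
  calc dist x y ≤ dist x (c i) + dist (c i) (c j) + dist (c j) y := dist_triangle4 _ _ _ _
    _ ≤ 2 * (p.length + 1) * ρ := by linarith
    _ ≤ 2 * k * ρ := by gcongr
end

section
/- Composite approximation bound underlying the k-center algorithm for arbitrary polygons: Let P be a nonempty subset of a metric space E, let X ⊆ P be nonempty with Metric.infDist p X ≤ a for every p ∈ P (X is an a-cover of P, e.g., obtained by sampling the polygons), and suppose there exists a finite set C₀ ⊆ E with |C₀| ≤ k and Metric.infDist p C₀ ≤ r for every p ∈ P (an unrestricted k-center solution of P with radius r). Then there exists a finite set C ⊆ X with |C| ≤ k such that Metric.infDist p C ≤ a + 2r for every p ∈ P; i.e., k centers chosen from the sample X cover all of P within radius a + 2r. -/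
/-- In a finite nonempty set the infimum distance is attained. -/
theorem Finset.exists_mem_dist_le_of_infDist_le {E : Type*} [PseudoMetricSpace E]
    {s : Finset E} (hs : s.Nonempty) {x : E} {r : ℝ}
    (h : Metric.infDist x (s : Set E) ≤ r) : ∃ c ∈ s, dist x c ≤ r := by
  obtain ⟨c, hc, hxc⟩ := s.finite_toSet.isCompact.exists_infDist_eq_dist
    (Finset.coe_nonempty.mpr hs) x
  exact ⟨c, hc, hxc ▸ h⟩

theorem composite_approx_kCenter_from_sample
    {E : Type*} [MetricSpace E] (P X : Set E) (hP : P.Nonempty)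
    (hXP : X ⊆ P) (hX : X.Nonempty) (a r : ℝ) (k : ℕ)
    (hPX : ∀ p ∈ P, Metric.infDist p X ≤ a)
    (hC₀ : ∃ C₀ : Finset E, C₀.card ≤ k ∧ ∀ p ∈ P, Metric.infDist p (C₀ : Set E) ≤ r) :
    ∃ C : Finset E, (C : Set E) ⊆ X ∧ C.card ≤ k ∧
      ∀ p ∈ P, Metric.infDist p (C : Set E) ≤ a + 2 * r := by
  classical
  obtain ⟨C₀, hcard, hcov⟩ := hC₀
  rcases C₀.eq_empty_or_nonempty with rfl | hne
  · refine ⟨∅, by simp, by simp, fun p hp => ?_⟩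
    have ha := Metric.infDist_nonneg.trans (hPX p hp)
    have hr := Metric.infDist_nonneg.trans (hcov p hp)
    simp only [Finset.coe_empty, Metric.infDist_empty]
    positivity
  have hrep : ∀ c : E, ∃ x ∈ X, ∀ y ∈ X, dist y c ≤ r → dist x c ≤ r := by
    intro c
    by_cases h : ∃ x ∈ X, dist x c ≤ r
    · obtain ⟨x, hx, hxc⟩ := h
      exact ⟨x, hx, fun _ _ _ => hxc⟩
    · obtain ⟨x, hx⟩ := hX
      exact ⟨x, hx, fun y hy hyc => (h ⟨y, hy, hyc⟩).elim⟩
  choose f hfX hf using hrep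
  refine ⟨C₀.image f, ?_, Finset.card_image_le.trans hcard, fun p hp => ?_⟩
  · simpa [Set.subset_def] using fun c _ => hfX c
  refine le_of_forall_pos_le_add fun ε hε => ?_
  obtain ⟨x, hx, hpx⟩ := (Metric.infDist_lt_iff hX).mp
    ((hPX p hp).trans_lt (lt_add_of_pos_right a hε))
  obtain ⟨c, hc, hxc⟩ := Finset.exists_mem_dist_le_of_infDist_le hne (hcov x (hXP hx))
  have hfc := hf c x hx hxc
  have hmem : f c ∈ (C₀.image f : Set E) := by exact_mod_cast Finset.mem_image_of_mem f hc
  have htri := dist_triangle4 p x c (f c)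
  rw [dist_comm c] at htri
  linarith [Metric.infDist_le_dist_of_mem (x := p) hmem]
end
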